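/- arXiv:1008.1193 — 5 statements merged into one kernel-verified Lean document; each statement's English description precedes it below -/
import Mathlib

section
/- Let m ≥ 2 and n ≥ 1, let X_0, …, X_{m-1} be invertible real n×n matrices, and let B_a, B_b be real n×n matrices such that N := B_a + B_b X_{m-1} X_{m-2} ⋯ X_0 is invertible. Set Y_j := -X_j for j = 0, …, m-2, L := X_0^{-1} ⋯ X_{m-2}^{-1}, and 𝓑 := B_b X_{m-1} + B_a L. Let 𝓜 be the mn×mn block matrix with diagonal blocks Y_0, …, Y_{m-2}, 𝓑, identity blocks I_n on the first block superdiagonal, and zero blocks elsewhere. Then the (0, m-1) block of 𝓜^{-1} equals L 𝓑^{-1} and the (m-1, m-1) block of 𝓜^{-1} equals 𝓑^{-1}. -/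
/-- The product of a list of invertible matrices in reverse order cancels against the product of
their inverses. -/
lemma Matrix.prod_reverse_mul_prod_inv {ι : Type*} [Fintype ι] [DecidableEq ι] {R : Type*}
    [CommRing R] (X : ℕ → Matrix ι ι R) (k : ℕ) (hX : ∀ j < k, IsUnit (X j)) :
    ((List.range k).map X).reverse.prod * ((List.range k).map fun j => (X j)⁻¹).prod = 1 := by
  induction k with
  | zero => simp
  | succ k ih =>
    have hk := (Matrix.isUnit_iff_isUnit_det _).mp (hX k k.lt_succ_self)
    have ih := ih fun j hj => hX j (hj.trans k.lt_succ_self)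
    simp only [List.range_succ, List.map_append, List.map_cons, List.map_nil, List.reverse_append,
      List.reverse_singleton, List.singleton_append, List.prod_cons, List.prod_append,
      List.prod_nil, mul_one]
    rw [mul_assoc, ← mul_assoc _ _ (X k)⁻¹, ih, one_mul, Matrix.mul_nonsing_inv _ hk]

/-- A block upper triangular matrix whose diagonal blocks are invertible is invertible. -/
lemma Matrix.isUnit_of_block_upper_triangular {κ ι : Type*} [Fintype κ] [LinearOrder κ]
    [Fintype ι] [DecidableEq ι] {R : Type*} [CommRing R] (M : Matrix (κ × ι) (κ × ι) R)
    (hlow : ∀ p q : κ × ι, q.1 < p.1 → M p q = 0)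
    (hdiag : ∀ k, IsUnit (M.submatrix (Prod.mk k) (Prod.mk k))) : IsUnit M := by
  have hM : M.BlockTriangular Prod.fst := fun p q h => hlow p q h
  rw [Matrix.isUnit_iff_isUnit_det, hM.det, IsUnit.prod_iff]
  intro k _
  let e : ι ≃ {p : κ × ι // p.1 = k} :=
    { toFun := fun a => ⟨(k, a), rfl⟩
      invFun := fun p => p.1.2
      left_inv := fun _ => rfl
      right_inv := by rintro ⟨⟨_, _⟩, rfl⟩; rfl }
  rw [← Matrix.det_submatrix_equiv_self e]
  exact (Matrix.isUnit_iff_isUnit_det _).mp (hdiag k)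

/-- If `M` is invertible and `M * C` is a submatrix of columns of the identity, then `C` consists
of the corresponding columns of `M⁻¹`. -/
lemma Matrix.submatrix_inv_eq_of_mul_eq {κ ι : Type*} [Fintype κ] [DecidableEq κ] {R : Type*}
    [CommRing R] {M : Matrix κ κ R} (hM : IsUnit M) {C : Matrix κ ι R} {f : ι → κ}
    (h : M * C = (1 : Matrix κ κ R).submatrix id f) : M⁻¹.submatrix id f = C := by
  have := Matrix.nonsing_inv_mul_cancel_left M C ((Matrix.isUnit_iff_isUnit_det _).mp hM)
  rw [← this, h]
  exact (Matrix.mul_submatrix_one (Equiv.refl κ) f M⁻¹).symm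


/-- With the notation of the multiple shooting setup, the `(0, m-1)` block of `𝓜⁻¹` equals
`L * 𝓑⁻¹` and the `(m-1, m-1)` block of `𝓜⁻¹` equals `𝓑⁻¹`. -/
theorem curlyM_inv_corner_blocks (m n : ℕ) (hm : 2 ≤ m) (hn : 1 ≤ n)
    (X : ℕ → Matrix (Fin n) (Fin n) ℝ)
    (hX : ∀ k < m, IsUnit (X k))
    (Ba Bb : Matrix (Fin n) (Fin n) ℝ)
    (N : Matrix (Fin n) (Fin n) ℝ)
    (hN : N = Ba + Bb * (((List.range m).map X).reverse).prod)
    (hNu : IsUnit N)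
    (Y : ℕ → Matrix (Fin n) (Fin n) ℝ)
    (hY : ∀ j, Y j = -(X j))
    (L 𝓑 : Matrix (Fin n) (Fin n) ℝ)
    (hL : L = (((List.range (m - 1)).map (fun k => (X k)⁻¹))).prod)
    (h𝓑 : 𝓑 = Bb * X (m - 1) + Ba * L)
    (𝓜 : Matrix (Fin m × Fin n) (Fin m × Fin n) ℝ)
    (h𝓜 : ∀ p q : Fin m × Fin n,
      𝓜 p q =
        if (p.1 : ℕ) = (q.1 : ℕ) then
          (if (p.1 : ℕ) = m - 1 then 𝓑 p.2 q.2 else Y (p.1 : ℕ) p.2 q.2)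
        else if (p.1 : ℕ) + 1 = (q.1 : ℕ) then (1 : Matrix (Fin n) (Fin n) ℝ) p.2 q.2
        else 0) :
    Matrix.of (fun a b => 𝓜⁻¹ ((⟨0, by omega⟩ : Fin m), a) ((⟨m - 1, by omega⟩ : Fin m), b)) =
        L * 𝓑⁻¹ ∧
    Matrix.of (fun a b => 𝓜⁻¹ ((⟨m - 1, by omega⟩ : Fin m), a) ((⟨m - 1, by omega⟩ : Fin m), b)) =
        𝓑⁻¹ := by
  obtain ⟨l, rfl⟩ : ∃ l, m = l + 1 := ⟨m - 1, by omega⟩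
  simp only [Nat.add_sub_cancel] at hL h𝓑 h𝓜 ⊢
  have h := Matrix.prod_reverse_mul_prod_inv X l fun j hj => hX j (by omega)
  rw [← hL] at h
  have hNL : N * L = 𝓑 := by
    rw [hN, h𝓑, List.range_succ, List.map_append, List.reverse_append, List.prod_append]
    simp only [List.map_cons, List.map_nil, List.reverse_singleton, List.prod_singleton]
    rw [add_mul, mul_assoc, mul_assoc, h, mul_one, add_comm]
  have hLu : IsUnit L := IsUnit.of_mul_eq_one_right _ h
  have h𝓑u : IsUnit 𝓑 := hNL ▸ hNu.mul hLu
  have hM : IsUnit 𝓜 := by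
    refine Matrix.isUnit_of_block_upper_triangular 𝓜 (fun p q hqp => ?_) fun k => ?_
    · have : (q.1 : ℕ) < p.1 := hqp
      rw [h𝓜, if_neg (by omega), if_neg (by omega)]
    · by_cases hk : (k : ℕ) = l
      · convert h𝓑u using 1
        ext a b
        simp [h𝓜, hk]
      · convert (hX k k.isLt).neg using 1
        ext a b
        simp [h𝓜, hk, hY]
  let P : ℕ → Matrix (Fin n) (Fin n) ℝ := fun i =>
    ((List.range' i (l - i)).map fun j => (X j)⁻¹).prod
  have hPl : P l = 1 := by simp [P]
  have hP0 : P 0 = L := by simp [P, hL, List.range_eq_range']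
  have hP : ∀ i < l, X i * P i = P (i + 1) := by
    intro i hi
    have h : l - i = (l - (i + 1)) + 1 := by omega
    simp only [P]
    rw [h, List.range'_succ, List.map_cons, List.prod_cons, ← mul_assoc,
      Matrix.mul_nonsing_inv _ ((Matrix.isUnit_iff_isUnit_det _).mp (hX i (by omega))), one_mul]
  let C : Matrix (Fin (l + 1) × Fin n) (Fin n) ℝ := Matrix.of fun p b => (P p.1 * 𝓑⁻¹) p.2 b
  have hMC : 𝓜 * C = (1 : Matrix (Fin (l + 1) × Fin n) _ ℝ).submatrix id
      (Prod.mk (Fin.last l)) := by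
    ext ⟨i, a⟩ b
    rw [Matrix.mul_apply, Fintype.sum_prod_type]
    have hrow : ∀ j : Fin (l + 1), ∑ c, 𝓜 (i, a) (j, c) * C (j, c) b =
        (if i = j then ((if (i : ℕ) = l then 𝓑 else Y i) * (P i * 𝓑⁻¹)) a b else 0) +
        (if (i : ℕ) + 1 = j then (P (i + 1) * 𝓑⁻¹) a b else 0) := by
      intro j
      by_cases hij : i = j
      · subst hij
        simp only [h𝓜, C, Matrix.of_apply, if_true, Nat.succ_ne_self, if_false, add_zero]
        rw [Matrix.mul_apply]
        split_ifs <;> rfl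
      · have hij' : (i : ℕ) ≠ j := fun h => hij (Fin.ext h)
        by_cases h : (i : ℕ) + 1 = j
        · simp [h𝓜, C, hij, hij', h, Matrix.one_apply]
        · simp [h𝓜, hij, hij', h]
    simp only [hrow, Finset.sum_add_distrib, Finset.sum_ite_eq, Finset.mem_univ, if_true]
    by_cases hi : (i : ℕ) = l
    · obtain rfl : i = Fin.last l := Fin.ext hi
      have h0 : ∀ j : Fin (l + 1), ¬ (l + 1 = (j : ℕ)) := fun j => by omega
      simp [h0, hPl, Matrix.mul_nonsing_inv _ ((Matrix.isUnit_iff_isUnit_det _).mp h𝓑u),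
        Matrix.one_apply]
    · have hil : (i : ℕ) < l := by omega
      have hne : i ≠ Fin.last l := fun h => hi (by simp [h])
      have h1 : ∀ j : Fin (l + 1), (i : ℕ) + 1 = j ↔ (⟨i + 1, by omega⟩ : Fin (l + 1)) = j :=
        fun j => by rw [Fin.ext_iff]
      simp [h1, hi, hY, ← mul_assoc, hP i hil, hne]
  have hC := Matrix.submatrix_inv_eq_of_mul_eq hM hMC
  constructor
  · ext a b
    exact (congrFun (congrFun hC (0, a)) b).trans (by simp [C, hP0])
  · ext a b
    exact (congrFun (congrFun hC (Fin.last l, a)) b).trans (by simp [C, hPl])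
end

section
/- Let m ≥ 2 and n ≥ 1, let X_0, …, X_{m-1} be invertible real n×n matrices, and let B_a, B_b be real n×n matrices such that N := B_a + B_b X_{m-1} X_{m-2} ⋯ X_0 is invertible. Set Y_j := -X_j for j = 0, …, m-2, L := X_0^{-1} ⋯ X_{m-2}^{-1}, and 𝓑 := B_b X_{m-1} + B_a L. Let 𝓜 be the mn×mn block matrix with diagonal blocks Y_0, …, Y_{m-2}, 𝓑, identity blocks I_n on the first block superdiagonal, and zero blocks elsewhere. Let U be the mn×n matrix whose block rows are 0, …, 0, B_a (i.e., U^⊤ = [0, …, 0, B_a^⊤]) and let V be the mn×n matrix with V^⊤ = [I_n, 0, …, 0, -L]. Then V^⊤ 𝓜^{-1} U = 0, and hence I_n + V^⊤ 𝓜^{-1} U = I_n is invertible. -/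
open Matrix

/-- If `R * U = 0`, then `R * M * M⁻¹ * U = 0`, whether or not `M` is invertible. -/
theorem mul_mul_nonsing_inv_mul_eq_zero {ι l k α : Type*} [Fintype ι] [DecidableEq ι]
    [CommRing α] (R : Matrix l ι α) (M : Matrix ι ι α) (U : Matrix ι k α) (h : R * U = 0) :
    R * M * M⁻¹ * U = 0 := by
  by_cases hM : IsUnit M.det
  · rw [Matrix.mul_nonsing_inv_cancel_right _ _ hM, h]
  · rw [Matrix.nonsing_inv_apply_not_isUnit _ hM, Matrix.mul_zero, Matrix.zero_mul]

/-- A block row times a block column of an upper bidiagonal block matrix with diagonal blocks `D`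
and identity superdiagonal blocks. -/
theorem sum_mul_bidiagonal {m n : ℕ} {α : Type*} [CommRing α]
    (R D : ℕ → Matrix (Fin n) (Fin n) α) (a c : Fin n) (j : Fin m) :
    (∑ p : Fin m × Fin n, R p.1 a p.2 *
      (if (p.1 : ℕ) = (j : ℕ) then D p.1 p.2 c
        else if (p.1 : ℕ) + 1 = (j : ℕ) then (1 : Matrix (Fin n) (Fin n) α) p.2 c else 0)) =
      (R j * D j) a c + if (j : ℕ) = 0 then 0 else R (j - 1) a c := by
  have key : ∀ i : ℕ, (∑ d : Fin n, R i a d *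
      (if i = (j : ℕ) then D i d c
        else if i + 1 = (j : ℕ) then (1 : Matrix (Fin n) (Fin n) α) d c else 0)) =
      (if i = (j : ℕ) then (R j * D j) a c else 0) +
        if i + 1 = (j : ℕ) then R i a c else 0 := by
    intro i
    by_cases h1 : i = (j : ℕ)
    · subst h1
      simp [Matrix.mul_apply]
    · by_cases h2 : i + 1 = (j : ℕ) <;> simp [h1, h2, Matrix.one_apply]
  rw [Fintype.sum_prod_type]
  simp only [key]
  rw [Fin.sum_univ_eq_sum_range (fun i => (if i = (j : ℕ) then (R j * D j) a c else 0) +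
        if i + 1 = (j : ℕ) then R i a c else 0), Finset.sum_add_distrib]
  congr 1
  · simp
  · obtain ⟨_ | k, hk⟩ := j
    · simp
    · simp [Nat.lt_of_succ_lt hk]

/-- With `U` the block column `(0, …, 0, Ba)` and `Vᵀ = [I, 0, …, 0, -L]`, we have
`Vᵀ * 𝓜⁻¹ * U = 0`, hence `I + Vᵀ * 𝓜⁻¹ * U = I` is invertible. -/
theorem VT_curlyMinv_U_eq_zero (m n : ℕ) (hm : 2 ≤ m) (hn : 1 ≤ n)
    (X : ℕ → Matrix (Fin n) (Fin n) ℝ)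
    (hX : ∀ k < m, IsUnit (X k))
    (Ba Bb : Matrix (Fin n) (Fin n) ℝ)
    (N : Matrix (Fin n) (Fin n) ℝ)
    (hN : N = Ba + Bb * (((List.range m).map X).reverse).prod)
    (hNu : IsUnit N)
    (Y : ℕ → Matrix (Fin n) (Fin n) ℝ)
    (hY : ∀ j, Y j = -(X j))
    (L 𝓑 : Matrix (Fin n) (Fin n) ℝ)
    (hL : L = (((List.range (m - 1)).map (fun k => (X k)⁻¹))).prod)
    (h𝓑 : 𝓑 = Bb * X (m - 1) + Ba * L)
    (𝓜 : Matrix (Fin m × Fin n) (Fin m × Fin n) ℝ)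
    (h𝓜 : ∀ p q : Fin m × Fin n,
      𝓜 p q =
        if (p.1 : ℕ) = (q.1 : ℕ) then
          (if (p.1 : ℕ) = m - 1 then 𝓑 p.2 q.2 else Y (p.1 : ℕ) p.2 q.2)
        else if (p.1 : ℕ) + 1 = (q.1 : ℕ) then (1 : Matrix (Fin n) (Fin n) ℝ) p.2 q.2
        else 0)
    (U V : Matrix (Fin m × Fin n) (Fin n) ℝ)
    (hU : ∀ (p : Fin m × Fin n) (b : Fin n),
      U p b = if (p.1 : ℕ) = m - 1 then Ba p.2 b else 0)
    (hV : ∀ (a : Fin n) (p : Fin m × Fin n),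
      Vᵀ a p =
        if (p.1 : ℕ) = 0 then (1 : Matrix (Fin n) (Fin n) ℝ) a p.2
        else if (p.1 : ℕ) = m - 1 then (-L) a p.2
        else 0) :
    Vᵀ * 𝓜⁻¹ * U = 0 ∧ IsUnit ((1 : Matrix (Fin n) (Fin n) ℝ) + Vᵀ * 𝓜⁻¹ * U) := by
  set P : ℕ → Matrix (Fin n) (Fin n) ℝ :=
    fun k => ((List.range k).map (fun k => (X k)⁻¹)).prod with hP
  have hP0 : P 0 = 1 := by simp [hP]
  have hPX : ∀ k < m, P (k + 1) * X k = P k := by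
    intro k hk
    have hdet := (Matrix.isUnit_iff_isUnit_det _).1 (hX k hk)
    simp [hP, List.range_succ, Matrix.mul_assoc, Matrix.nonsing_inv_mul _ hdet]
  set B : ℕ → Matrix (Fin n) (Fin n) ℝ := fun k => if k = m - 1 then 0 else -P (k + 1) with hB
  set R : Matrix (Fin n) (Fin m × Fin n) ℝ := fun a p => B p.1 a p.2 with hR
  have hRU : R * U = 0 := by
    ext a b
    rw [Matrix.mul_apply]
    refine Finset.sum_eq_zero fun p _ => ?_
    rw [hU]
    by_cases h : (p.1 : ℕ) = m - 1 <;> simp [hR, hB, h]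
  have hRM : Vᵀ = R * 𝓜 := by
    ext a ⟨j, c⟩
    have hsum := sum_mul_bidiagonal B (fun i => if i = m - 1 then 𝓑 else Y i) a c j
    have hij : (R * 𝓜) a (j, c) = (B j * if (j : ℕ) = m - 1 then 𝓑 else Y j) a c +
        if (j : ℕ) = 0 then 0 else B (j - 1) a c := by
      rw [← hsum, Matrix.mul_apply]
      refine Finset.sum_congr rfl fun p _ => ?_
      rw [h𝓜]
      split_ifs <;> rfl
    rw [hij, hV]
    have hj := j.isLt
    by_cases h0 : (j : ℕ) = 0
    · have h1 : (0 : ℕ) ≠ m - 1 := by omega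
      have := hPX 0 (by omega)
      simp only [zero_add] at this
      simp [h0, h1, hB, hY, this, hP0]
    · have h2 : (j : ℕ) - 1 ≠ m - 1 := by omega
      have h3 : (j : ℕ) - 1 + 1 = j := by omega
      by_cases h1 : (j : ℕ) = m - 1
      · have h4 : P (m - 1) = L := hL.symm
        have hBj : B j = 0 := if_pos h1
        have hBp : B (j - 1) = -L := by
          rw [← h4, ← h1, hB]
          simp only [h2, if_false, h3]
        rw [if_neg h0, if_pos h1, if_neg h0, hBj, hBp, Matrix.zero_mul]
        simp
      · simp [h0, h1, h2, h3, hB, hY, hPX j hj]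
  have h : Vᵀ * 𝓜⁻¹ * U = 0 := by
    rw [hRM]
    exact mul_mul_nonsing_inv_mul_eq_zero R 𝓜 U hRU
  exact ⟨h, by simp [h]⟩
end

section
/- Let m ≥ 2 and n ≥ 1, let X_0, …, X_{m-1} be invertible real n×n matrices, and let B_a, B_b be real n×n matrices such that N := B_a + B_b X_{m-1} X_{m-2} ⋯ X_0 is invertible. Set Y_j := -X_j for j = 0, …, m-2, L := X_0^{-1} ⋯ X_{m-2}^{-1}, and 𝓑 := B_b X_{m-1} + B_a L. Let M be the mn×mn block matrix whose (j,j) block is Y_j and (j,j+1) block is I_n for j = 0, …, m-2, whose (m-1,0) block is B_a, whose (m-1,m-1) block is B_b X_{m-1}, and whose remaining blocks are zero. Let 𝓜 be the mn×mn block matrix with diagonal blocks Y_0, …, Y_{m-2}, 𝓑, identity blocks I_n on the first block superdiagonal, and zero blocks elsewhere, let U be the mn×n block column matrix (0, …, 0, B_a), and let V^⊤ = [I_n, 0, …, 0, -L]. Then M = 𝓜 + U V^⊤, M is invertible, and M^{-1} = 𝓜^{-1} - 𝓜^{-1} U V^⊤ 𝓜^{-1}. -/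
open Matrix

theorem prod_reverse_map_range_succ {R : Type*} [Monoid R] (X : ℕ → R) (k : ℕ) :
    (((List.range (k + 1)).map X).reverse).prod
      = X k * (((List.range k).map X).reverse).prod := by
  simp [List.range_succ]

theorem prod_map_inv_mul_prod_reverse {ι K : Type*} [Fintype ι] [DecidableEq ι] [CommRing K]
    (X : ℕ → Matrix ι ι K) (k : ℕ) (hX : ∀ j < k, IsUnit (X j)) :
    ((List.range k).map fun j => (X j)⁻¹).prod * (((List.range k).map X).reverse).prod = 1 := by
  induction k with
  | zero => simp
  | succ k ih =>
    have hk : (X k)⁻¹ * X k = 1 :=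
      Matrix.nonsing_inv_mul _ ((Matrix.isUnit_iff_isUnit_det _).1 (hX k k.lt_succ_self))
    rw [prod_reverse_map_range_succ, List.range_succ, List.map_append, List.prod_append]
    simp only [List.map_cons, List.map_nil, List.prod_singleton]
    rw [mul_assoc, ← mul_assoc (X k)⁻¹, hk, one_mul, ih fun j hj => hX j (by omega)]

/-- A solution of the recursion `z (k + 1) = X k *ᵥ z k` is propagated by the products of the
`X k`. -/
theorem eq_prod_reverse_mulVec {ι K : Type*} [Fintype ι] [DecidableEq ι] [CommRing K]
    (X : ℕ → Matrix ι ι K) (z : ℕ → ι → K) (N : ℕ)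
    (hz : ∀ k < N, z (k + 1) = X k *ᵥ z k) :
    z N = (((List.range N).map X).reverse).prod *ᵥ z 0 := by
  induction N with
  | zero => simp
  | succ N ih =>
    rw [hz N N.lt_succ_self, ih fun k hk => hz k (by omega), prod_reverse_map_range_succ,
      Matrix.mulVec_mulVec]

/-- The Sherman–Morrison–Woodbury update in the case where the capacitance matrix is `1`. -/
theorem add_mul_mul_inv_sub_eq_one {ι κ K : Type*} [Fintype ι] [DecidableEq ι] [Fintype κ]
    [CommRing K] (A : Matrix ι ι K) (hA : IsUnit A) (U : Matrix ι κ K) (W : Matrix κ ι K)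
    (h : W * (A⁻¹ * U) = 0) :
    (A + U * W) * (A⁻¹ - A⁻¹ * U * W * A⁻¹) = 1 := by
  have hA' : A * A⁻¹ = 1 := Matrix.mul_nonsing_inv _ ((Matrix.isUnit_iff_isUnit_det _).1 hA)
  have h1 : A * (A⁻¹ * U * W * A⁻¹) = U * W * A⁻¹ := by
    simp only [← Matrix.mul_assoc, hA', Matrix.one_mul]
  have h2 : U * W * (A⁻¹ * U * W * A⁻¹) = 0 := by
    calc U * W * (A⁻¹ * U * W * A⁻¹) = U * (W * (A⁻¹ * U)) * W * A⁻¹ := by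
          simp only [Matrix.mul_assoc]
      _ = 0 := by simp [h]
  rw [Matrix.add_mul, Matrix.mul_sub, Matrix.mul_sub, h1, h2, hA']
  abel

/-- The multiple shooting matrix `M` decomposes as `M = 𝓜 + U * Vᵀ`, `M` is invertible, and
`M⁻¹ = 𝓜⁻¹ - 𝓜⁻¹ * U * Vᵀ * 𝓜⁻¹` (Sherman–Morrison–Woodbury update). -/
theorem M_eq_curlyM_add_UVT_and_inv (m n : ℕ) (hm : 2 ≤ m) (hn : 1 ≤ n)
    (X : ℕ → Matrix (Fin n) (Fin n) ℝ)
    (hX : ∀ k < m, IsUnit (X k))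
    (Ba Bb : Matrix (Fin n) (Fin n) ℝ)
    (N : Matrix (Fin n) (Fin n) ℝ)
    (hN : N = Ba + Bb * (((List.range m).map X).reverse).prod)
    (hNu : IsUnit N)
    (Y : ℕ → Matrix (Fin n) (Fin n) ℝ)
    (hY : ∀ j, Y j = -(X j))
    (L 𝓑 : Matrix (Fin n) (Fin n) ℝ)
    (hL : L = (((List.range (m - 1)).map (fun k => (X k)⁻¹))).prod)
    (h𝓑 : 𝓑 = Bb * X (m - 1) + Ba * L)
    (M : Matrix (Fin m × Fin n) (Fin m × Fin n) ℝ)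
    (hM : ∀ p q : Fin m × Fin n,
      M p q =
        if (p.1 : ℕ) = m - 1 then
          (if (q.1 : ℕ) = 0 then Ba p.2 q.2
           else if (q.1 : ℕ) = m - 1 then (Bb * X (m - 1)) p.2 q.2
           else 0)
        else if (p.1 : ℕ) = (q.1 : ℕ) then Y (p.1 : ℕ) p.2 q.2
        else if (p.1 : ℕ) + 1 = (q.1 : ℕ) then (1 : Matrix (Fin n) (Fin n) ℝ) p.2 q.2
        else 0)
    (𝓜 : Matrix (Fin m × Fin n) (Fin m × Fin n) ℝ)
    (h𝓜 : ∀ p q : Fin m × Fin n,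
      𝓜 p q =
        if (p.1 : ℕ) = (q.1 : ℕ) then
          (if (p.1 : ℕ) = m - 1 then 𝓑 p.2 q.2 else Y (p.1 : ℕ) p.2 q.2)
        else if (p.1 : ℕ) + 1 = (q.1 : ℕ) then (1 : Matrix (Fin n) (Fin n) ℝ) p.2 q.2
        else 0)
    (U V : Matrix (Fin m × Fin n) (Fin n) ℝ)
    (hU : ∀ (p : Fin m × Fin n) (b : Fin n),
      U p b = if (p.1 : ℕ) = m - 1 then Ba p.2 b else 0)
    (hV : ∀ (a : Fin n) (p : Fin m × Fin n),
      Vᵀ a p =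
        if (p.1 : ℕ) = 0 then (1 : Matrix (Fin n) (Fin n) ℝ) a p.2
        else if (p.1 : ℕ) = m - 1 then (-L) a p.2
        else 0) :
    M = 𝓜 + U * Vᵀ ∧ IsUnit M ∧ M⁻¹ = 𝓜⁻¹ - 𝓜⁻¹ * U * Vᵀ * 𝓜⁻¹ := by
  have hM_eq : M = 𝓜 + U * Vᵀ := by
    ext p q
    have hUV : (U * Vᵀ) p q = ∑ b, (if (p.1 : ℕ) = m - 1 then Ba p.2 b else 0) *
        (if (q.1 : ℕ) = 0 then (1 : Matrix (Fin n) (Fin n) ℝ) b q.2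
          else if (q.1 : ℕ) = m - 1 then (-L) b q.2 else 0) := by
      rw [Matrix.mul_apply]
      exact Finset.sum_congr rfl fun b _ => by rw [hU, hV]
    rw [Matrix.add_apply, hM, h𝓜, hUV]
    have hq := q.1.isLt
    by_cases hp : (p.1 : ℕ) = m - 1
    · have h0 : (0 : ℕ) ≠ m - 1 := by omega
      have hq1 : (m - 1 + 1 : ℕ) ≠ q.1 := by omega
      by_cases hq0 : (q.1 : ℕ) = 0
      · have hm0 : ¬ m - 1 = 0 := h0.symm
        simp [hp, hq0, hm0, Matrix.one_apply]
      · by_cases hqm : (q.1 : ℕ) = m - 1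
        · have hm0 : ¬ m - 1 = 0 := h0.symm
          simp [hp, hqm, hm0, h𝓑, Matrix.mul_apply, Finset.sum_neg_distrib]
        · simp [hp, hq0, hqm, hq1, Ne.symm hqm]
    · simp [hp]
  let block (z : Fin m × Fin n → ℝ) (k : ℕ) (b : Fin n) : ℝ :=
    if h : k < m then z (⟨k, h⟩, b) else 0
  have block_coe (z : Fin m × Fin n → ℝ) (i : Fin m) (b : Fin n) :
      block z i b = z (i, b) := by simp [block]
  have h𝓜_row (z : Fin m × Fin n → ℝ) (k : ℕ) (hk : k < m - 1) (a : Fin n) :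
      (𝓜 *ᵥ z) (⟨k, by omega⟩, a) = block z (k + 1) a - (X k *ᵥ block z k) a := by
    rw [Matrix.mulVec, dotProduct, Fintype.sum_prod_type,
      Fintype.sum_eq_add (⟨k, by omega⟩ : Fin m) ⟨k + 1, by omega⟩ (by simp)]
    · have hk1 : k + 1 < m := by omega
      have hk0 : k < m := by omega
      simp [h𝓜, hk.ne, hY, block, hk1, hk0, Matrix.one_apply, Matrix.mulVec, dotProduct]
      ring
    · rintro j ⟨h1, h2⟩
      have h1' : ¬ k = j := fun h => h1 (Fin.ext h.symm)
      have h2' : ¬ k + 1 = j := fun h => h2 (Fin.ext h.symm)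
      simp [h𝓜, h1', h2']
  have h𝓜_last (z : Fin m × Fin n → ℝ) (a : Fin n) :
      (𝓜 *ᵥ z) (⟨m - 1, by omega⟩, a) = (𝓑 *ᵥ block z (m - 1)) a := by
    have hm1 : m - 1 < m := by omega
    rw [Matrix.mulVec, dotProduct, Fintype.sum_prod_type,
      Fintype.sum_eq_single (⟨m - 1, by omega⟩ : Fin m)]
    · simp [h𝓜, block, hm1, Matrix.mulVec, dotProduct]
    · intro j h1
      have h1' : ¬ m - 1 = j := fun h => h1 (Fin.ext h.symm)
      have h2' : ¬ m - 1 + 1 = j := by omega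
      simp [h𝓜, h1', h2']
  have hVz (z : Fin m × Fin n → ℝ) :
      Vᵀ *ᵥ z = block z 0 - L *ᵥ block z (m - 1) := by
    ext a
    have hm0 : 0 < m := by omega
    have hm1 : m - 1 < m := by omega
    have hne : ¬ m - 1 = 0 := by omega
    have hne' : ¬ 0 = m - 1 := by omega
    rw [Matrix.mulVec, dotProduct, Fintype.sum_prod_type,
      Fintype.sum_eq_add (⟨0, hm0⟩ : Fin m) ⟨m - 1, hm1⟩ (by simpa using hne')]
    · simp only [hV]
      simp [hne, block, hm0, hm1, Matrix.one_apply, Matrix.mulVec, dotProduct, sub_eq_add_neg]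
    · rintro j ⟨h1, h2⟩
      have h1' : ¬ (j : ℕ) = 0 := fun h => h1 (Fin.ext h)
      have h2' : ¬ (j : ℕ) = m - 1 := fun h => h2 (Fin.ext h)
      simp only [hV]
      simp [h1', h2']
  have hLP : L * (((List.range (m - 1)).map X).reverse).prod = 1 := by
    rw [hL]
    exact prod_map_inv_mul_prod_reverse X (m - 1) fun j hj => hX j (by omega)
  have propagate (z : Fin m × Fin n → ℝ) (N : ℕ) (hN : N ≤ m - 1)
      (hz : ∀ (k : ℕ) (hk : k < m - 1) (a : Fin n), (𝓜 *ᵥ z) (⟨k, by omega⟩, a) = 0) :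
      block z N = (((List.range N).map X).reverse).prod *ᵥ block z 0 := by
    refine eq_prod_reverse_mulVec X (block z) N fun k hk => ?_
    ext a
    have := hz k (by omega) a
    rw [h𝓜_row z k (by omega)] at this
    linarith
  have hN𝓑 : N = 𝓑 * (((List.range (m - 1)).map X).reverse).prod := by
    have hsucc := prod_reverse_map_range_succ X (m - 1)
    rw [Nat.sub_add_cancel (by omega : 1 ≤ m)] at hsucc
    rw [hN, h𝓑, hsucc, add_mul, mul_assoc Ba, hLP, mul_one, mul_assoc, add_comm]
  have h𝓜u : IsUnit 𝓜 := by
    rw [← Matrix.mulVec_injective_iff_isUnit, ← Matrix.coe_mulVecLin, injective_iff_map_eq_zero]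
    intro z hz
    rw [Matrix.mulVecLin_apply] at hz
    have hz' := fun (K : ℕ) (hK : K ≤ m - 1) =>
      propagate z K hK fun k hk a => by rw [hz]; rfl
    have h0 : N *ᵥ block z 0 = 0 := by
      rw [hN𝓑, ← Matrix.mulVec_mulVec, ← hz' (m - 1) le_rfl]
      ext a
      rw [← h𝓜_last, hz]
      rfl
    have h0' : block z 0 = 0 :=
      Matrix.mulVec_injective_iff_isUnit.2 hNu (by rw [h0, Matrix.mulVec_zero])
    ext ⟨i, b⟩
    rw [← block_coe z, hz' i (by omega), h0', Matrix.mulVec_zero]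
    rfl
  have hVU : Vᵀ * (𝓜⁻¹ * U) = 0 := by
    ext a c
    have hU' : 𝓜 *ᵥ (𝓜⁻¹ * U).col c = U.col c := by
      have h : 𝓜 * (𝓜⁻¹ * U) = U := by
        rw [← Matrix.mul_assoc,
          Matrix.mul_nonsing_inv _ ((Matrix.isUnit_iff_isUnit_det _).1 h𝓜u), Matrix.one_mul]
      ext p
      exact congrFun (congrFun h p) c
    have hlast := propagate ((𝓜⁻¹ * U).col c) (m - 1) le_rfl fun k hk a => by
      rw [hU']
      simp [hU, hk.ne]
    change (Vᵀ *ᵥ (𝓜⁻¹ * U).col c) a = 0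
    rw [hVz, hlast, Matrix.mulVec_mulVec, hLP, Matrix.one_mulVec, sub_self]
    rfl
  have hinv : M * (𝓜⁻¹ - 𝓜⁻¹ * U * Vᵀ * 𝓜⁻¹) = 1 := by
    rw [hM_eq]
    exact add_mul_mul_inv_sub_eq_one 𝓜 h𝓜u U Vᵀ hVU
  exact ⟨hM_eq, IsUnit.of_mul_eq_one _ hinv, Matrix.inv_eq_right_inv hinv⟩
end

section
/- Let m ≥ 2 and n ≥ 1, let X_0, …, X_{m-1} be invertible real n×n matrices, and let B_a, B_b be real n×n matrices such that N := B_a + B_b X_{m-1} X_{m-2} ⋯ X_0 is invertible. Set Y_j := -X_j for j = 0, …, m-2, L := X_0^{-1} ⋯ X_{m-2}^{-1}, and 𝓑 := B_b X_{m-1} + B_a L. Let M be the mn×mn block matrix whose (j,j) block is Y_j and (j,j+1) block is I_n for j = 0, …, m-2, whose (m-1,0) block is B_a, whose (m-1,m-1) block is B_b X_{m-1}, and whose remaining blocks are zero. Let q = (q_0, …, q_{m-1}) ∈ ℝ^{mn}. Define ξ = (ξ_0, …, ξ_{m-1}) by ξ_{m-1} := 𝓑^{-1} q_{m-1} and ξ_j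 := Y_j^{-1}(q_j - ξ_{j+1}) for j = m-2, …, 0; define ζ = (ζ_0, …, ζ_{m-1}) by ζ_{m-1} := 𝓑^{-1} B_a (ξ_0 - L ξ_{m-1}) and ζ_j := -Y_j^{-1} ζ_{j+1} for j = m-2, …, 0; and set c := ξ - ζ. Then M c = q. -/
open Matrix

/-- The product of `X (k-1) ⋯ X 0` with `(X 0)⁻¹ ⋯ (X (k-1))⁻¹` is the identity. -/
theorem reverse_prod_mul_inv_prod {ι R : Type*} [Fintype ι] [DecidableEq ι] [CommRing R]
    (X : ℕ → Matrix ι ι R) (k : ℕ) (hX : ∀ j < k, IsUnit (X j)) :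
    (((List.range k).map X).reverse).prod *
      ((List.range k).map (fun j => (X j)⁻¹)).prod = 1 := by
  induction k with
  | zero => simp
  | succ k ih =>
    have hk : X k * (X k)⁻¹ = 1 :=
      Matrix.mul_nonsing_inv _ ((Matrix.isUnit_iff_isUnit_det _).1 (hX k k.lt_succ_self))
    have ih' := ih fun j hj => hX j (hj.trans k.lt_succ_self)
    simp only [List.range_succ, List.map_append, List.reverse_append, List.prod_append,
      List.map_cons, List.map_nil, List.reverse_singleton, List.prod_singleton]
    rw [Matrix.mul_assoc, ← Matrix.mul_assoc _ _ (X k)⁻¹, ih', Matrix.one_mul, hk]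

/-- If block row `i` of `M` has the blocks `A` and `B` in the distinct block columns `a` and `b`
and vanishes elsewhere, then block `i` of `M v` is `A v_a + B v_b`. -/
theorem mulVec_apply_of_two_blocks {ι κ R : Type*} [Fintype ι] [DecidableEq ι] [Fintype κ]
    [NonUnitalNonAssocSemiring R] (M : Matrix (ι × κ) (ι × κ) R) (v : ι × κ → R)
    {a b : ι} (hab : a ≠ b) (A B : Matrix κ κ R) (i : ι) (r : κ)
    (hA : ∀ s, M (i, r) (a, s) = A r s) (hB : ∀ s, M (i, r) (b, s) = B r s)
    (h0 : ∀ j s, j ≠ a → j ≠ b → M (i, r) (j, s) = 0) :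
    M.mulVec v (i, r) =
      A.mulVec (fun s => v (a, s)) r + B.mulVec (fun s => v (b, s)) r := by
  simp only [Matrix.mulVec, dotProduct, Fintype.sum_prod_type]
  rw [Fintype.sum_eq_add a b hab]
  · simp only [hA, hB]
  · rintro j ⟨ha, hb⟩
    exact Finset.sum_eq_zero fun s _ => by rw [h0 j s ha hb, zero_mul]

/-- Correctness of the Sherman–Morrison–Woodbury based algorithm: with `ξ` obtained by
backward substitution from `𝓜 ξ = q`, `ζ` obtained by backward substitution from
`𝓜 ζ = 𝓤 ξ`, and `c = ξ - ζ`, the stacked vector `c` satisfies `M c = q`. -/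
theorem smw_algorithm_correct (m n : ℕ) (hm : 2 ≤ m) (hn : 1 ≤ n)
    (X : ℕ → Matrix (Fin n) (Fin n) ℝ)
    (hX : ∀ k < m, IsUnit (X k))
    (Ba Bb : Matrix (Fin n) (Fin n) ℝ)
    (N : Matrix (Fin n) (Fin n) ℝ)
    (hN : N = Ba + Bb * (((List.range m).map X).reverse).prod)
    (hNu : IsUnit N)
    (Y : ℕ → Matrix (Fin n) (Fin n) ℝ)
    (hY : ∀ j, Y j = -(X j))
    (L 𝓑 : Matrix (Fin n) (Fin n) ℝ)
    (hL : L = (((List.range (m - 1)).map (fun k => (X k)⁻¹))).prod)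
    (h𝓑 : 𝓑 = Bb * X (m - 1) + Ba * L)
    (M : Matrix (Fin m × Fin n) (Fin m × Fin n) ℝ)
    (hM : ∀ p q : Fin m × Fin n,
      M p q =
        if (p.1 : ℕ) = m - 1 then
          (if (q.1 : ℕ) = 0 then Ba p.2 q.2
           else if (q.1 : ℕ) = m - 1 then (Bb * X (m - 1)) p.2 q.2
           else 0)
        else if (p.1 : ℕ) = (q.1 : ℕ) then Y (p.1 : ℕ) p.2 q.2
        else if (p.1 : ℕ) + 1 = (q.1 : ℕ) then (1 : Matrix (Fin n) (Fin n) ℝ) p.2 q.2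
        else 0)
    (q ξ ζ c : ℕ → (Fin n → ℝ))
    (hξlast : ξ (m - 1) = 𝓑⁻¹.mulVec (q (m - 1)))
    (hξrec : ∀ j, j < m - 1 → ξ j = (Y j)⁻¹.mulVec (q j - ξ (j + 1)))
    (hζlast : ζ (m - 1) = 𝓑⁻¹.mulVec (Ba.mulVec (ξ 0 - L.mulVec (ξ (m - 1)))))
    (hζrec : ∀ j, j < m - 1 → ζ j = -((Y j)⁻¹.mulVec (ζ (j + 1))))
    (hc : ∀ j, c j = ξ j - ζ j) :
    M.mulVec (fun p => c (p.1 : ℕ) p.2) = (fun p => q (p.1 : ℕ) p.2) := by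
  obtain ⟨k, rfl⟩ : ∃ k, m = k + 1 := ⟨m - 1, by omega⟩
  simp only [Nat.add_sub_cancel] at *
  have hk : 0 < k := by omega
  have hPL := reverse_prod_mul_inv_prod X k fun j hj => hX j (by omega)
  rw [← hL] at hPL
  have hNL : 𝓑 = N * L := by
    rw [h𝓑, hN, List.range_succ, List.map_append, List.reverse_append, List.prod_append]
    simp only [List.map_cons, List.map_nil, List.reverse_singleton, List.prod_singleton]
    rw [Matrix.add_mul, Matrix.mul_assoc Bb, Matrix.mul_assoc (X k), hPL, Matrix.mul_one,
      add_comm]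
  have hdet : IsUnit 𝓑.det := by
    rw [hNL, ← Matrix.isUnit_iff_isUnit_det]
    exact hNu.mul (IsUnit.of_mul_eq_one_right _ hPL)
  have hYdet : ∀ j < k, IsUnit (Y j).det := fun j hj => by
    rw [← Matrix.isUnit_iff_isUnit_det, hY]
    exact (hX j (by omega)).neg
  have hYinv : ∀ j < k, (Y j)⁻¹ = -(X j)⁻¹ := fun j hj => by
    refine Matrix.inv_eq_right_inv ?_
    rw [hY, neg_mul_neg,
      Matrix.mul_nonsing_inv _ ((Matrix.isUnit_iff_isUnit_det _).1 (hX j (by omega)))]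
  have hζ0 : ζ 0 = L.mulVec (ζ k) := by
    have key : ∀ j ≤ k, ζ 0 =
        ((List.range j).map (fun i => (X i)⁻¹)).prod.mulVec (ζ j) := by
      intro j
      induction j with
      | zero => simp
      | succ j ih =>
        intro hj
        rw [ih (by omega), hζrec j (by omega), hYinv j (by omega), Matrix.neg_mulVec,
          neg_neg, Matrix.mulVec_mulVec]
        simp [List.range_succ]
    rw [hL]
    exact key k le_rfl
  have hξB : 𝓑.mulVec (ξ k) = q k := by
    rw [hξlast, Matrix.mulVec_mulVec, Matrix.mul_nonsing_inv _ hdet, Matrix.one_mulVec]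
  have hζB : 𝓑.mulVec (ζ k) = Ba.mulVec (ξ 0 - L.mulVec (ξ k)) := by
    rw [hζlast, Matrix.mulVec_mulVec, Matrix.mul_nonsing_inv _ hdet, Matrix.one_mulVec]
  have hlast : Ba.mulVec (c 0) + (Bb * X k).mulVec (c k) = q k := by
    rw [h𝓑, Matrix.add_mulVec, ← Matrix.mulVec_mulVec _ Ba] at hξB hζB
    rw [hc, hc, hζ0, ← hξB]
    simp only [Matrix.mulVec_sub] at hζB ⊢
    linear_combination -hζB
  have hrow : ∀ j < k, (Y j).mulVec (c j) + c (j + 1) = q j := by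
    intro j hj
    rw [hc, hc, hξrec j hj, hζrec j hj, sub_neg_eq_add, ← Matrix.mulVec_add,
      Matrix.mulVec_mulVec, Matrix.mul_nonsing_inv _ (hYdet j hj), Matrix.one_mulVec]
    abel
  funext ⟨i, r⟩
  by_cases hi : (i : ℕ) = k
  · rw [mulVec_apply_of_two_blocks M _ (a := 0) (b := Fin.last k)
      (by simp [Fin.ext_iff]; omega) Ba (Bb * X k) i r
      (fun s => by simp [hM, hi]) (fun s => by simp [hM, hi, hk.ne'])
      (fun j s h0 h1 => by
        have h0' : (j : ℕ) ≠ 0 := fun h => h0 (Fin.ext h)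
        have h1' : (j : ℕ) ≠ k := fun h => h1 (Fin.ext h)
        simp only [hM, hi, h0', h1', if_true, if_false])]
    simpa [hi] using congrFun hlast r
  · have hik : (i : ℕ) < k := by omega
    rw [mulVec_apply_of_two_blocks M _ (a := i) (b := ⟨i + 1, by omega⟩)
      (by simp [Fin.ext_iff]) (Y i) 1 i r
      (fun s => by simp [hM, hi]) (fun s => by simp [hM, hi])
      (fun j s h0 h1 => by
        have h0' : (i : ℕ) ≠ j := fun h => h0 (Fin.ext h.symm)
        have h1' : (i : ℕ) + 1 ≠ j := fun h => h1 (Fin.ext h.symm)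
        simp only [hM, hi, h0', h1', if_false])]
    simpa using congrFun (hrow i hik) r
end

section
/- Let m ≥ 2 and n ≥ 1, let X_0, …, X_{m-1} be invertible real n×n matrices, and let B_a, B_b be real n×n matrices such that E := B_a + B_b X_{m-1} X_{m-2} ⋯ X_0 is invertible. Set Y_j := -X_j for j = 0, …, m-2. Let M be the mn×mn block matrix whose (j,j) block is Y_j and (j,j+1) block is I_n for j = 0, …, m-2, whose (m-1,0) block is B_a, whose (m-1,m-1) block is B_b X_{m-1}, and whose remaining blocks are zero. Let q = (q_0, …, q_{m-1}) ∈ ℝ^{mn}, and set u := q_{m-1} - B_b X_{m-1}(q_{m-2} + X_{m-2} q_{m-3} + ⋯ + X_{m-2} X_{m-3} ⋯ X_1 q_0). Define c_0 := E^{-1} u and c_{j+1} := q_j + X_j c_j for j = 0, …, m-2. Then the stacked vector c = (c_0, …, c_{m-1}) ∈ ℝ^{mn} satisfies M c = q. -/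
open Matrix

/-- The action of a block matrix on a stacked vector, block row by block row. -/
lemma mulVec_stacked_apply {m : ℕ} {ι R : Type*} [Fintype ι] [NonUnitalNonAssocSemiring R]
    (A : ℕ → ℕ → Matrix ι ι R) (c : ℕ → ι → R) (p : Fin m × ι) :
    (Matrix.of fun p q : Fin m × ι => A p.1 q.1 p.2 q.2).mulVec (fun p => c p.1 p.2) p =
      ∑ j ∈ Finset.range m, (A p.1 j).mulVec (c j) p.2 := by
  rw [Finset.sum_range]
  simp only [Matrix.mulVec, dotProduct, Matrix.of_apply, Fintype.sum_prod_type]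

/-- The solution of the recursion `c (j + 1) = q j + X j (c j)` in terms of `c 0` and `q`. -/
lemma affine_recursion_solution {ι R : Type*} [Fintype ι] [DecidableEq ι] [CommRing R]
    (X : ℕ → Matrix ι ι R) (q c : ℕ → ι → R) (N : ℕ)
    (hc : ∀ j < N, c (j + 1) = q j + (X j).mulVec (c j)) :
    c N = (((List.range N).map X).reverse.prod).mulVec (c 0) +
      ∑ j ∈ Finset.range N,
        (((List.range' (j + 1) (N - 1 - j)).map X).reverse.prod).mulVec (q j) := by
  induction N with
  | zero => simp
  | succ k ih =>
    rw [hc k k.lt_succ_self, ih fun j hj => hc j (by omega), Finset.sum_range_succ,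
      Matrix.mulVec_add, Matrix.mulVec_sum]
    have hstep : ∀ j ∈ Finset.range k,
        (X k).mulVec ((((List.range' (j + 1) (k - 1 - j)).map X).reverse.prod).mulVec (q j)) =
          (((List.range' (j + 1) (k + 1 - 1 - j)).map X).reverse.prod).mulVec (q j) := by
      intro j hj
      have hjk := Finset.mem_range.mp hj
      rw [show k + 1 - 1 - j = (k - 1 - j) + 1 by omega, List.range'_concat,
        show j + 1 + 1 * (k - 1 - j) = k by omega]
      simp [Matrix.mulVec_mulVec]
    rw [Finset.sum_congr rfl hstep]
    simp only [List.range_succ, List.map_append, List.reverse_append, List.prod_append,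
      List.map_singleton, List.reverse_singleton, List.prod_singleton, Matrix.mulVec_mulVec,
      Nat.add_sub_cancel, Nat.sub_self, List.range'_zero, List.map_nil, List.reverse_nil,
      List.prod_nil, Matrix.one_mulVec]
    abel

/-- Correctness of the Condensing method of Stoer and Bulirsch: with
`u = q (m-1) - Bb X_{m-1} (q_{m-2} + X_{m-2} q_{m-3} + ⋯ + X_{m-2} ⋯ X_1 q_0)`,
`c 0 = E⁻¹ u` and `c (j+1) = q j + X j (c j)`, the stacked vector `c` solves `M c = q`. -/
theorem condensing_correct (m n : ℕ) (hm : 2 ≤ m) (hn : 1 ≤ n)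
    (X : ℕ → Matrix (Fin n) (Fin n) ℝ)
    (hX : ∀ k < m, IsUnit (X k))
    (Ba Bb : Matrix (Fin n) (Fin n) ℝ)
    (E : Matrix (Fin n) (Fin n) ℝ)
    (hE : E = Ba + Bb * (((List.range m).map X).reverse).prod)
    (hEu : IsUnit E)
    (Y : ℕ → Matrix (Fin n) (Fin n) ℝ)
    (hY : ∀ j, Y j = -(X j))
    (M : Matrix (Fin m × Fin n) (Fin m × Fin n) ℝ)
    (hM : ∀ p q : Fin m × Fin n,
      M p q =
        if (p.1 : ℕ) = m - 1 then
          (if (q.1 : ℕ) = 0 then Ba p.2 q.2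
           else if (q.1 : ℕ) = m - 1 then (Bb * X (m - 1)) p.2 q.2
           else 0)
        else if (p.1 : ℕ) = (q.1 : ℕ) then Y (p.1 : ℕ) p.2 q.2
        else if (p.1 : ℕ) + 1 = (q.1 : ℕ) then (1 : Matrix (Fin n) (Fin n) ℝ) p.2 q.2
        else 0)
    (q c : ℕ → (Fin n → ℝ))
    (u : Fin n → ℝ)
    (hu : u = q (m - 1) -
      (Bb * X (m - 1)).mulVec
        (∑ j ∈ Finset.range (m - 1),
          ((((List.range' (j + 1) (m - 2 - j)).map X).reverse).prod).mulVec (q j)))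
    (hc0 : c 0 = E⁻¹.mulVec u)
    (hcrec : ∀ j, j < m - 1 → c (j + 1) = q j + (X j).mulVec (c j)) :
    M.mulVec (fun p => c (p.1 : ℕ) p.2) = (fun p => q (p.1 : ℕ) p.2) := by
  have hboundary : Ba.mulVec (c 0) + (Bb * X (m - 1)).mulVec (c (m - 1)) = q (m - 1) := by
    have hEc : E.mulVec (c 0) = u := by
      rw [hc0, Matrix.mulVec_mulVec,
        Matrix.mul_nonsing_inv _ ((Matrix.isUnit_iff_isUnit_det E).mp hEu), Matrix.one_mulVec]
    have hprod : ((List.range m).map X).reverse.prod =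
        X (m - 1) * ((List.range (m - 1)).map X).reverse.prod := by
      obtain ⟨k, rfl⟩ : ∃ k, m = k + 1 := ⟨m - 1, by omega⟩
      simp [List.range_succ]
    rw [hu, hE, hprod, Matrix.add_mulVec, ← Matrix.mul_assoc, ← Matrix.mulVec_mulVec,
      eq_sub_iff_add_eq] at hEc
    rw [affine_recursion_solution X q c (m - 1) hcrec, Matrix.mulVec_add, ← add_assoc]
    exact hEc
  let A : ℕ → ℕ → Matrix (Fin n) (Fin n) ℝ := fun i j =>
    if i = m - 1 then (if j = 0 then Ba else if j = m - 1 then Bb * X (m - 1) else 0)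
    else if i = j then Y i else if i + 1 = j then 1 else 0
  have hMA : M = Matrix.of fun p q : Fin m × Fin n => A p.1 q.1 p.2 q.2 := by
    ext p q
    rw [hM, Matrix.of_apply]
    simp only [A]
    split_ifs <;> rfl
  ext p
  obtain ⟨⟨i, hi⟩, a⟩ := p
  rw [hMA, mulVec_stacked_apply]
  by_cases hlast : i = m - 1
  · subst hlast
    rw [Finset.sum_eq_add_of_mem 0 (m - 1) (by simp; omega) (by simp; omega) (by omega)]
    · simpa [A, show m - 1 ≠ 0 by omega] using congrFun hboundary a
    · rintro j - ⟨h0, h1⟩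
      simp [A, h0, h1]
  · rw [Finset.sum_eq_add_of_mem i (i + 1) (by simp; omega) (by simp; omega) (by omega)]
    · simp [A, hlast, hY, hcrec i (by omega), Matrix.neg_mulVec]
    · rintro j - ⟨h0, h1⟩
      simp [A, hlast, Ne.symm h0, Ne.symm h1]
end
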